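/- Let θ ∈ [1/2, 1]. For all real numbers a, b, c, (((2θ+1)/2)·a − 2θ·b + ((2θ−1)/2)·c)·(θ·a + (1−θ)·b) = (1/2)·q_θ(a,b) − (1/2)·q_θ(b,c) + (θ(2θ−1)/4)·(a − 2b + c)². -/

import Mathlib

/-- The scalar G-quadratic form `q_θ(w,v)` on pairs of real numbers. -/
noncomputable def gquadScalar (θ w v : ℝ) : ℝ :=
  θ * (2 * θ + 3) / 2 * w ^ 2 + θ * (2 * θ - 1) / 2 * v ^ 2
    - (θ + 1) * (2 * θ - 1) * (w * v)

theorem gquadScalar_identity (θ : ℝ) (hθ : θ ∈ Set.Icc (1 / 2 : ℝ) 1) (a b c : ℝ) :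
    ((2 * θ + 1) / 2 * a - 2 * θ * b + (2 * θ - 1) / 2 * c) * (θ * a + (1 - θ) * b)
      = (1 / 2) * gquadScalar θ a b - (1 / 2) * gquadScalar θ b c
        + θ * (2 * θ - 1) / 4 * (a - 2 * b + c) ^ 2 := by
  unfold gquadScalar
  ring
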